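/- arXiv:1112.3140 — 2 statements merged into one kernel-verified Lean document; each statement's English description precedes it below -/
import Mathlib

section
/- (Allan's local principle) Let 𝒜 be a unital complex Banach algebra and let 𝒞 be a central subalgebra of 𝒜, i.e., a closed subalgebra of the center of 𝒜 containing the identity. For each maximal ideal x of the commutative Banach algebra 𝒞, let I_x be the smallest closed two-sided ideal of 𝒜 containing x, and let Φ_x : 𝒜 → 𝒜/I_x be the canonical homomorphism (with the convention that if I_x = 𝒜, then Φ_x(a) is declared invertible for every a). Then an element a ∈ 𝒜 is invertible in 𝒜 if and only if Φ_x(a) is invertible in 𝒜/I_x for every maximal ideal x of 𝒞. -/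
/-- In a Banach algebra over `ℂ`, every central element is congruent to a scalar modulo
a given maximal left ideal. -/
theorem exists_algebraMap_sub_mem_of_mem_center
    {A : Type*} [NormedRing A] [NormedAlgebra ℂ A] [CompleteSpace A]
    (M : Ideal A) [hM : M.IsMaximal] {c : A} (hc : c ∈ Subalgebra.center ℂ A) :
    ∃ z : ℂ, algebraMap ℂ A z - c ∈ M := by
  let S : Submodule ℂ A := M.restrictScalars ℂ
  have : IsClosed (S : Set A) := Ideal.IsMaximal.isClosed (I := M)
  have hS : S ≠ ⊤ := fun h ↦ hM.ne_top <| by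
    rw [Ideal.eq_top_iff_one]
    exact (h ▸ Submodule.mem_top : (1 : A) ∈ S)
  have : Nontrivial (A ⧸ S) := Submodule.Quotient.nontrivial_iff.2 hS
  let T : (A ⧸ S) →L[ℂ] (A ⧸ S) :=
    S.liftQL (S.mkQL ∘L ContinuousLinearMap.mul ℂ A c) fun _ hx ↦
      (Submodule.Quotient.mk_eq_zero S).2 (M.mul_mem_left c hx)
  obtain ⟨z, hz⟩ := spectrum.nonempty T
  refine ⟨z, ?_⟩
  by_contra hd
  set d := algebraMap ℂ A z - c with hd_def
  have hd_comm (x : A) : d * x = x * d := by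
    rw [hd_def, sub_mul, mul_sub, Algebra.commutes, Subalgebra.mem_center_iff.1 hc x]
  have hT (x : A) : (algebraMap ℂ ((A ⧸ S) →L[ℂ] (A ⧸ S)) z - T) (S.mkQ x) = S.mkQ (d * x) := by
    have hTx : T (S.mkQ x) = S.mkQ (c * x) := rfl
    rw [sub_apply, hTx, hd_def, sub_mul, map_sub, ← Algebra.smul_def, map_smul,
      Algebra.algebraMap_eq_smul_one, smul_apply, one_apply_eq_self]
  refine hz (ContinuousLinearMap.isUnit_iff_bijective.2 ⟨?_, fun y ↦ ?_⟩)
  · rw [injective_iff_map_eq_zero]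
    intro y hy
    obtain ⟨x, rfl⟩ := S.mkQ_surjective y
    rw [hT] at hy
    have hy : d * x ∈ M := (Submodule.Quotient.mk_eq_zero S).1 hy
    refine (Submodule.Quotient.mk_eq_zero S).2 (?_ : x ∈ M)
    by_contra hx
    obtain ⟨r, m, hm, h⟩ := hM.exists_inv hx
    refine hd ?_
    rw [← mul_one d, ← h, mul_add, ← mul_assoc, hd_comm r, mul_assoc]
    exact M.add_mem (M.mul_mem_left _ hy) (M.mul_mem_left _ hm)
  · obtain ⟨x, rfl⟩ := S.mkQ_surjective y
    obtain ⟨r, m, hm, h⟩ := hM.exists_inv hd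
    refine ⟨S.mkQ (x * r), ?_⟩
    rw [hT]
    refine (Submodule.Quotient.eq S).2 (?_ : d * (x * r) - x ∈ M)
    have : d * (x * r) - x = -(x * m) := by
      rw [hd_comm, mul_assoc, eq_sub_of_add_eq h]
      noncomm_ring
    rw [this]
    exact M.neg_mem (M.mul_mem_left _ hm)

/-- A maximal left ideal of a complex Banach algebra contracts to a maximal ideal of any
central subalgebra. -/
theorem isMaximal_comap_val_of_le_center
    {A : Type*} [NormedRing A] [NormedAlgebra ℂ A] [CompleteSpace A]
    {C : Subalgebra ℂ A} (hC : C ≤ Subalgebra.center ℂ A) (M : Ideal A) [hM : M.IsMaximal] :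
    (M.comap C.val).IsMaximal := by
  refine Ideal.isMaximal_iff.2 ⟨fun h ↦ hM.ne_top ((Ideal.eq_top_iff_one M).2 (by simpa using h)),
    fun J c hJ hc hcJ ↦ ?_⟩
  obtain ⟨z, hz⟩ := exists_algebraMap_sub_mem_of_mem_center M (hC c.2)
  have hzJ : algebraMap ℂ C z ∈ J := by
    have : algebraMap ℂ C z - c ∈ J := hJ (by simpa [Ideal.mem_comap] using hz)
    simpa using J.add_mem this hcJ
  have hz0 : z ≠ 0 := by
    rintro rfl
    exact hc (by simpa [Ideal.mem_comap] using hz)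
  have := J.mul_mem_left (algebraMap ℂ C z⁻¹) hzJ
  rwa [← map_mul, inv_mul_cancel₀ hz0, map_one] at this

/-- A left ideal containing a set of central elements contains the two-sided ideal
generated by that set. -/
theorem TwoSidedIdeal.span_subset_of_subset_center {R : Type*} [Ring R] {s : Set R}
    (hs : s ⊆ Subring.center R) (M : Ideal R) (hsM : s ⊆ M) :
    (TwoSidedIdeal.span s : Set R) ⊆ M := by
  let J : TwoSidedIdeal R := .mk' {x | ∀ y, x * y ∈ M} (by simp)
    (fun hx hy z ↦ by rw [add_mul]; exact M.add_mem (hx z) (hy z))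
    (fun hx z ↦ by rw [neg_mul]; exact M.neg_mem (hx z))
    (fun hy z ↦ by rw [mul_assoc]; exact M.mul_mem_left _ (hy z))
    (fun hx z ↦ by rw [mul_assoc]; exact hx _)
  have hJ : s ⊆ J := fun c hc ↦ (TwoSidedIdeal.mem_mk' ..).2 fun y ↦ by
    rw [← Subring.mem_center_iff.1 (hs hc) y]
    exact M.mul_mem_left _ (hsM hc)
  intro x hx
  simpa using (TwoSidedIdeal.mem_mk' ..).1 (TwoSidedIdeal.mem_span_iff.1 hx J hJ) 1

/-- The one-sided form of Allan's local principle: an element that is left invertible modulo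
the closed two-sided ideal generated by each maximal ideal of a central subalgebra is left
invertible. -/
theorem exists_mul_eq_one_of_forall_isMaximal
    {A : Type*} [NormedRing A] [NormedAlgebra ℂ A] [CompleteSpace A]
    {C : Subalgebra ℂ A} (hC : C ≤ Subalgebra.center ℂ A) {a : A}
    (h : ∀ x : Ideal C, x.IsMaximal → ∃ b : A,
      b * a - 1 ∈ closure (TwoSidedIdeal.span ((Subtype.val : C → A) '' (x : Set C)) : Set A)) :
    ∃ b, b * a = 1 := by
  suffices Ideal.span {a} = ⊤ by
    rwa [Ideal.eq_top_iff_one, Ideal.mem_span_singleton'] at this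
  by_contra hne
  obtain ⟨M, hM, haM⟩ := Ideal.exists_le_maximal _ hne
  obtain ⟨b, hb⟩ := h _ (isMaximal_comap_val_of_le_center hC M)
  have hsub := TwoSidedIdeal.span_subset_of_subset_center
    (s := (Subtype.val : C → A) '' (M.comap C.val : Set C))
    (by rintro _ ⟨c, -, rfl⟩
        exact Subring.mem_center_iff.2 (Subalgebra.mem_center_iff.1 (hC c.2))) M
    (by rintro _ ⟨c, hc, rfl⟩; exact hc)
  have hbM : b * a - 1 ∈ M := closure_minimal hsub Ideal.IsMaximal.isClosed hb
  refine hM.ne_top ((Ideal.eq_top_iff_one M).2 ?_)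
  have haM : b * a ∈ M := M.mul_mem_left b (haM (Ideal.mem_span_singleton_self a))
  simpa using M.sub_mem haM hbM

/-- **Allan's local principle.** Let `𝒜` be a unital complex Banach algebra, `𝒞` a closed
central subalgebra containing the identity. For a maximal ideal `x` of `𝒞`, the smallest
closed two-sided ideal of `𝒜` containing `x` is the closure of the two-sided ideal generated
by (the image in `𝒜` of) `x`, and invertibility of `Φ_x(a)` in the quotient `𝒜/I_x` means
the existence of `b` with `a * b - 1 ∈ I_x` and `b * a - 1 ∈ I_x` (this holds trivially when
`I_x = 𝒜`, which encodes the convention). Then `a` is invertible in `𝒜` iff all its local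
representatives are invertible. -/
theorem allan_local_principle
    {𝒜 : Type*} [NormedRing 𝒜] [NormedAlgebra ℂ 𝒜] [CompleteSpace 𝒜]
    (𝒞 : Subalgebra ℂ 𝒜) (h_closed : IsClosed (𝒞 : Set 𝒜))
    (h_central : 𝒞 ≤ Subalgebra.center ℂ 𝒜) (a : 𝒜) :
    IsUnit a ↔ ∀ x : Ideal 𝒞, x.IsMaximal →
      ∃ b : 𝒜,
        a * b - 1 ∈ closure ((TwoSidedIdeal.span
          ((Subtype.val : 𝒞 → 𝒜) '' (x : Set 𝒞)) : TwoSidedIdeal 𝒜) : Set 𝒜) ∧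
        b * a - 1 ∈ closure ((TwoSidedIdeal.span
          ((Subtype.val : 𝒞 → 𝒜) '' (x : Set 𝒞)) : TwoSidedIdeal 𝒜) : Set 𝒜) := by
  refine ⟨fun ha x _ ↦ ?_, fun h ↦ ?_⟩
  · obtain ⟨u, rfl⟩ := ha
    have h0 : (0 : 𝒜) ∈ closure ((TwoSidedIdeal.span
        ((Subtype.val : 𝒞 → 𝒜) '' (x : Set 𝒞)) : TwoSidedIdeal 𝒜) : Set 𝒜) :=
      subset_closure (zero_mem _)
    exact ⟨↑u⁻¹, by simpa using h0, by simpa using h0⟩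
  obtain ⟨b, hb⟩ := exists_mul_eq_one_of_forall_isMaximal h_central fun x hx ↦
    (h x hx).imp fun _ ↦ And.right
  obtain ⟨c, hc⟩ := exists_mul_eq_one_of_forall_isMaximal (a := b) h_central fun x hx ↦ by
    obtain ⟨b', hb', -⟩ := h x hx
    let J : Ideal 𝒜 :=
      (TwoSidedIdeal.asIdeal (TwoSidedIdeal.span ((Subtype.val : 𝒞 → 𝒜) '' (x : Set 𝒞)))).closure
    have hJ : (J : Set 𝒜) = closure (TwoSidedIdeal.span
        ((Subtype.val : 𝒞 → 𝒜) '' (x : Set 𝒞)) : Set 𝒜) := by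
      rw [Ideal.coe_closure, TwoSidedIdeal.coe_asIdeal]
    rw [← hJ] at hb' ⊢
    have hab : a * b - 1 = (a * b' - 1) - a * b * (a * b' - 1) := by
      have : a * b * (a * b') = a * b' := by rw [mul_assoc, ← mul_assoc b, hb, one_mul]
      rw [mul_sub, this, mul_one]
      abel
    refine ⟨a, ?_⟩
    rw [hab]
    exact J.sub_mem hb' (J.mul_mem_left _ hb')
  have hca : c = a := by
    rw [← mul_one c, ← hb, ← mul_assoc, hc, one_mul]
  exact ⟨⟨a, b, hca ▸ hc, hb⟩, rfl⟩
end

section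
/- (Two idempotents theorem) Let 𝒜 be a unital complex Banach algebra with identity e, let p and q be idempotents in 𝒜 (p² = p, q² = q), and let 𝓑 be the smallest closed subalgebra of 𝒜 containing p, q and e. Suppose 0 and 1 belong to the spectrum σ_𝓑(pqp) of pqp in 𝓑 and that 0 and 1 are cluster points of σ_𝓑(pqp). Then: (a) for each x ∈ σ_𝓑(pqp) there is a continuous unital algebra homomorphism Φ_x : 𝓑 → ℂ^{2×2} with Φ_x(p) = [1, 0; 0, 0] and Φ_x(q) = [x, s; s, 1−x], where s is any complex number with s² = x(1−x); (b) an element b ∈ 𝓑 is invertible in 𝓑 if and only if Φ_x(b) is invertible for every x ∈ σ_𝓑(pqp). -/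
namespace TwoIdempotents

section Ring

variable {R : Type*} [Ring R]

/-- The central element `1 - (p - q)²` attached to a pair of idempotents. -/
def cosSq (p q : R) : R := 1 - p - q + p * q + q * p

theorem compl_idem {p : R} (hp : p * p = p) : (1 - p) * (1 - p) = 1 - p := by
  simp [mul_sub, sub_mul, hp]

theorem cosSq_compl (p q : R) : cosSq (1 - p) (1 - q) = cosSq p q := by
  unfold cosSq
  noncomm_ring

/-- Reassociated form of idempotency, for use as a simp rule. -/
theorem idem_mul {p : R} (hp : p * p = p) (z : R) : p * (p * z) = p * z := by
  rw [← mul_assoc, hp]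

theorem cosSq_comm_left {p q : R} (hp : p * p = p) : p * cosSq p q = cosSq p q * p := by
  simp only [cosSq, mul_add, mul_sub, add_mul, sub_mul, mul_assoc, hp, idem_mul hp, mul_one,
    one_mul]
  abel

theorem cosSq_comm_right {p q : R} (hq : q * q = q) : q * cosSq p q = cosSq p q * q := by
  simp only [cosSq, mul_add, mul_sub, add_mul, sub_mul, mul_assoc, hq, idem_mul hq, mul_one,
    one_mul]
  abel

end Ring

variable {B : Type*} [NormedRing B] [NormedAlgebra ℂ B]

/-- Every closed subspace containing `1` and stable under left multiplication by `p` and `q`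
is the whole algebra. -/
def TopGenerates (p q : B) : Prop :=
  ∀ S : Submodule ℂ B, IsClosed (S : Set B) → 1 ∈ S → (∀ b ∈ S, p * b ∈ S) →
    (∀ b ∈ S, q * b ∈ S) → ∀ b, b ∈ S

theorem TopGenerates.compl {p q : B} (h : TopGenerates p q) :
    TopGenerates (1 - p) (1 - q) := by
  intro S hS h1 hp hq
  refine h S hS h1 (fun b hb => ?_) (fun b hb => ?_)
  · simpa [sub_mul] using S.sub_mem hb (hp b hb)
  · simpa [sub_mul] using S.sub_mem hb (hq b hb)

theorem TopGenerates.commute {p q : B} (h : TopGenerates p q) {z : B} (hp : p * z = z * p)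
    (hq : q * z = z * q) (b : B) : b * z = z * b := by
  have hmem : ∀ {u : B}, u ∈ Subalgebra.centralizer ℂ {z} ↔ z * u = u * z := by
    simp [Subalgebra.mem_centralizer_iff]
  have := h (Subalgebra.toSubmodule (Subalgebra.centralizer ℂ {z}))
    (Set.isClosed_centralizer _) (one_mem (Subalgebra.centralizer ℂ {z}))
    (fun b hb => (Subalgebra.centralizer ℂ {z}).mul_mem (hmem.2 hp.symm) hb)
    (fun b hb => (Subalgebra.centralizer ℂ {z}).mul_mem (hmem.2 hq.symm) hb) b
  exact (hmem.1 this).symm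

theorem TopGenerates.cosSq_central {p q : B} (h : TopGenerates p q) (hp : p * p = p)
    (hq : q * q = q) (b : B) : b * cosSq p q = cosSq p q * b :=
  h.commute (cosSq_comm_left hp) (cosSq_comm_right hq) b

/-- The elements `α + β p + γ q + δ pq` with central coefficients. -/
def centralSpan (p q : B) : Submodule ℂ B where
  carrier := {b | ∃ α ∈ Subalgebra.center ℂ B, ∃ β ∈ Subalgebra.center ℂ B,
    ∃ γ ∈ Subalgebra.center ℂ B, ∃ δ ∈ Subalgebra.center ℂ B,
    b = α + β * p + γ * q + δ * (p * q)}
  add_mem' := by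
    rintro _ _ ⟨α, hα, β, hβ, γ, hγ, δ, hδ, rfl⟩ ⟨α', hα', β', hβ', γ', hγ', δ', hδ', rfl⟩
    refine ⟨_, add_mem hα hα', _, add_mem hβ hβ', _, add_mem hγ hγ', _, add_mem hδ hδ', ?_⟩
    simp only [add_mul]
    abel
  zero_mem' := ⟨0, zero_mem _, 0, zero_mem _, 0, zero_mem _, 0, zero_mem _, by simp⟩
  smul_mem' := by
    rintro r _ ⟨α, hα, β, hβ, γ, hγ, δ, hδ, rfl⟩
    exact ⟨_, Subalgebra.smul_mem _ hα r, _, Subalgebra.smul_mem _ hβ r,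
      _, Subalgebra.smul_mem _ hγ r, _, Subalgebra.smul_mem _ hδ r, by simp [smul_add]⟩

theorem TopGenerates.center {p q : B} (h : TopGenerates p q) (hp : p * p = p)
    (hq : q * q = q) : cosSq p q ∈ Subalgebra.center ℂ B :=
  Subalgebra.mem_center_iff.2 (h.cosSq_central hp hq)

theorem TopGenerates.mem_of_centralSpan {p q : B} (h : TopGenerates p q) (hp : p * p = p)
    (hq : q * q = q) {T : Set B} (hT : IsClosed T) (hmem : ∀ b ∈ centralSpan p q, b ∈ T)
    (b : B) : b ∈ T := by
  have hc := h.center hp hq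
  have hstep : ∀ u : B, (∀ b ∈ centralSpan p q, u * b ∈ centralSpan p q) →
      ∀ b ∈ (centralSpan p q).topologicalClosure, u * b ∈ (centralSpan p q).topologicalClosure :=
    fun u hu b hb => map_mem_closure (continuous_const_mul u) hb hu
  have hb : b ∈ (centralSpan p q).topologicalClosure := by
    refine h _ (Submodule.isClosed_topologicalClosure _) ?_ (hstep p ?_) (hstep q ?_) b
    · exact Submodule.le_topologicalClosure _
        ⟨1, one_mem _, 0, zero_mem _, 0, zero_mem _, 0, zero_mem _, by simp⟩
    · rintro _ ⟨α, hα, β, hβ, γ, hγ, δ, hδ, rfl⟩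
      refine ⟨0, zero_mem _, _, add_mem hα hβ, 0, zero_mem _, _, add_mem hγ hδ, ?_⟩
      rw [Subalgebra.mem_center_iff] at hα hβ hγ hδ
      simp only [mul_add, add_mul, ← mul_assoc, hα, hβ, hγ, hδ, zero_mul, zero_add, add_zero]
      simp only [mul_assoc, hp]
      abel
    · rintro _ ⟨α, hα, β, hβ, γ, hγ, δ, hδ, rfl⟩
      refine ⟨_, mul_mem hβ (sub_mem hc (one_mem _)), β, hβ,
        _, add_mem (add_mem (add_mem hα hβ) hγ) (mul_mem hδ hc),
        _, neg_mem hβ, ?_⟩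
      rw [Subalgebra.mem_center_iff] at hα hβ hγ hδ
      simp only [mul_add, ← mul_assoc, hα, hβ, hγ, hδ]
      simp only [cosSq, mul_add, mul_sub, add_mul, sub_mul, mul_assoc, hq, mul_one, neg_mul]
      abel
  exact closure_minimal hmem hT hb

theorem exists_corner {p q : B} (hc : cosSq p q ∈ Subalgebra.center ℂ B) (hp : p * p = p)
    {b : B} (hb : b ∈ centralSpan p q) : ∃ ζ ∈ Subalgebra.center ℂ B, p * b * p = ζ * p := by
  obtain ⟨α, hα, β, hβ, γ, hγ, δ, hδ, rfl⟩ := hb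
  refine ⟨_, add_mem (add_mem (add_mem hα hβ) (mul_mem hγ hc)) (mul_mem hδ hc), ?_⟩
  rw [Subalgebra.mem_center_iff] at hα hβ hγ hδ
  simp only [mul_add, ← mul_assoc, hα, hβ, hγ, hδ]
  simp only [cosSq, mul_add, mul_sub, add_mul, sub_mul, mul_assoc, hp, mul_one]
  abel

theorem exists_upper {p q : B} (hp : p * p = p) {b : B} (hb : b ∈ centralSpan p q) :
    ∃ ζ ∈ Subalgebra.center ℂ B, p * b * (1 - p) = ζ * (p * q * (1 - p)) := by
  obtain ⟨α, hα, β, hβ, γ, hγ, δ, hδ, rfl⟩ := hb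
  refine ⟨_, add_mem hγ hδ, ?_⟩
  rw [Subalgebra.mem_center_iff] at hα hβ hγ hδ
  simp only [mul_add, ← mul_assoc, hα, hβ, hγ, hδ]
  simp only [mul_sub, add_mul, mul_assoc, hp, mul_one]
  abel

theorem exists_lower {p q : B} (hp : p * p = p) {b : B} (hb : b ∈ centralSpan p q) :
    ∃ ζ ∈ Subalgebra.center ℂ B, (1 - p) * b * p = ζ * ((1 - p) * q * p) := by
  obtain ⟨α, hα, β, hβ, γ, hγ, δ, hδ, rfl⟩ := hb
  refine ⟨γ, hγ, ?_⟩
  rw [Subalgebra.mem_center_iff] at hα hβ hγ hδ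
  simp only [mul_add, ← mul_assoc, hα, hβ, hγ, hδ]
  simp only [mul_sub, sub_mul, add_mul, mul_assoc, hp, mul_one]
  abel

theorem TopGenerates.corner_comm {p q : B} (h : TopGenerates p q) (hp : p * p = p)
    (hq : q * q = q) (a b : B) : p * a * p * b * p = p * b * p * a * p := by
  refine h.mem_of_centralSpan hp hq (T := {a | p * a * p * b * p = p * b * p * a * p})
    (isClosed_eq (by fun_prop) (by fun_prop)) (fun a ha => ?_) a
  obtain ⟨ζ, hζ, e⟩ := exists_corner (h.center hp hq) hp ha
  rw [Subalgebra.mem_center_iff] at hζ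
  calc p * a * p * b * p = ζ * p * b * p := by rw [e]
    _ = p * b * (ζ * p) := by rw [← mul_assoc (p * b), hζ (p * b)]; simp only [mul_assoc]
    _ = p * b * p * a * p := by rw [← e]; simp only [mul_assoc]

theorem TopGenerates.comm_of_commute {p q : B} (h : TopGenerates p q) (hp : p * p = p)
    (hq : q * q = q) {a b : B} (ha : p * a = a * p) (hb : p * b = b * p) : a * b = b * a := by
  have h1 := h.corner_comm hp hq a b
  have h2 := h.compl.corner_comm (compl_idem hp) (compl_idem hq) a b
  have r : ∀ a b : B, p * a = a * p → p * b = b * p → p * a * p * b * p = p * (a * b) := by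
    intro a b ha hb
    rw [ha, mul_assoc a, hp, mul_assoc, mul_assoc, ← hb, idem_mul hp, ← mul_assoc, ← ha, mul_assoc]
  have hc : ∀ a : B, p * a = a * p → (1 - p) * a = a * (1 - p) := by
    intro a ha; simp [mul_sub, sub_mul, ha]
  have r' : ∀ a b : B, p * a = a * p → p * b = b * p →
      (1 - p) * a * (1 - p) * b * (1 - p) = (1 - p) * (a * b) := by
    intro a b ha hb
    rw [hc a ha, mul_assoc a, compl_idem hp, mul_assoc, mul_assoc, ← hc b hb,
      idem_mul (compl_idem hp), ← mul_assoc, ← hc a ha, mul_assoc]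
  rw [r a b ha hb, r b a hb ha] at h1
  rw [r' a b ha hb, r' b a hb ha] at h2
  simpa [sub_mul, h1] using h2

theorem exists_character [CompleteSpace B] (comm : ∀ a b : B, a * b = b * a) {a : B}
    (ha : ¬ IsUnit a) : ∃ φ : B →ₐ[ℂ] ℂ, Continuous φ ∧ φ a = 0 := by
  let _ : NormedCommRing B := { (inferInstance : NormedRing B) with mul_comm := comm }
  obtain ⟨φ, hφ⟩ := WeakDual.CharacterSpace.exists_apply_eq_zero (A := B) ha
  exact ⟨WeakDual.CharacterSpace.toAlgHom φ, map_continuous φ, hφ⟩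

/-- `f` is the compression to the corner `pBp` followed by a character of the corner
sending `pqp` to `x`. -/
structure IsCornerCharacter (p q : B) (x : ℂ) (f : B →L[ℂ] ℂ) : Prop where
  map_one : f 1 = 1
  map_right : f q = x
  map_mul_mul : ∀ a b, f (a * p * b) = f a * f b

theorem exists_isCornerCharacter_of_character {p q : B} (hp : p * p = p) {x : ℂ}
    (φ : Subalgebra.centralizer ℂ {p} →ₐ[ℂ] ℂ) (hφ : Continuous φ)
    (hmem : ∀ b, p * b * p ∈ Subalgebra.centralizer ℂ {p})
    (hone : φ ⟨p * 1 * p, hmem 1⟩ = 1) (hq : φ ⟨p * q * p, hmem q⟩ = x) :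
    ∃ f, IsCornerCharacter p q x f := by
  refine ⟨{ toFun := fun b => φ ⟨p * b * p, hmem b⟩
            map_add' := fun a b => ?_
            map_smul' := fun r a => ?_
            cont := hφ.comp (by fun_prop) }, hone, hq, fun a b => ?_⟩
  · rw [← map_add]
    congr 2
    simp [mul_add, add_mul]
  · rw [RingHom.id_apply, ← map_smul]
    congr 2
    simp
  · change φ _ = φ _ * φ _
    rw [← map_mul]
    congr 2
    simp [mul_assoc, idem_mul hp]

/-- An element that fails to be invertible exactly when `pqp - x` fails to be so in the corner. -/
def cornerShift (p q : B) (x : ℂ) : B := p * q * p - x • p + (1 - p)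

theorem TopGenerates.exists_centralizer_character [CompleteSpace B] {p q : B}
    (h : TopGenerates p q) (hp : p * p = p) (hq : q * q = q)
    (a : Subalgebra.centralizer ℂ {p}) (ha : ¬ IsUnit (a : B)) :
    ∃ φ : Subalgebra.centralizer ℂ {p} →ₐ[ℂ] ℂ, Continuous φ ∧ φ a = 0 := by
  have : IsClosed (Subalgebra.centralizer ℂ {p} : Set B) := Set.isClosed_centralizer _
  have : CompleteSpace (Subalgebra.centralizer ℂ {p}) := this.completeSpace_coe
  have hmem : ∀ {u : B}, u ∈ Subalgebra.centralizer ℂ {p} ↔ p * u = u * p := by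
    simp [Subalgebra.mem_centralizer_iff]
  refine exists_character (fun a b => Subtype.ext ?_) (fun hu => ha ?_)
  · exact h.comm_of_commute hp hq (hmem.1 a.2) (hmem.1 b.2)
  · exact hu.map (Subalgebra.centralizer ℂ {p}).val

theorem TopGenerates.exists_isCornerCharacter [CompleteSpace B] {p q : B}
    (h : TopGenerates p q) (hp : p * p = p) (hq : q * q = q) {x : ℂ}
    (hx : ¬ IsUnit (cornerShift p q x)) : ∃ f, IsCornerCharacter p q x f := by
  have hmem : ∀ {u : B}, u ∈ Subalgebra.centralizer ℂ {p} ↔ p * u = u * p := by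
    simp [Subalgebra.mem_centralizer_iff]
  have hmem' : ∀ b, p * b * p ∈ Subalgebra.centralizer ℂ {p} := fun b =>
    hmem.2 (by simp [mul_assoc, hp, idem_mul hp])
  let P : Subalgebra.centralizer ℂ {p} := ⟨p, hmem.2 rfl⟩
  let Q : Subalgebra.centralizer ℂ {p} := ⟨p * q * p, hmem' q⟩
  have hP : P * P = P := Subtype.ext hp
  have hPQ : P * Q = Q := Subtype.ext (by simp [P, Q, mul_assoc, idem_mul hp])
  obtain ⟨φ, hφ, h0⟩ := h.exists_centralizer_character hp hq (Q - x • P + (1 - P)) hx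
  have e1 : φ P * φ P = φ P := by rw [← map_mul, hP]
  have e2 : φ P * φ Q = φ Q := by rw [← map_mul, hPQ]
  simp only [map_add, map_sub, map_smul, map_one, smul_eq_mul] at h0
  have hP1 : φ P = 1 := by
    by_contra hne
    have hz : φ P = 0 := by
      rcases mul_eq_zero.1 (show φ P * (φ P - 1) = 0 by linear_combination e1) with h | h
      · exact h
      · exact absurd (sub_eq_zero.1 h) hne
    rw [hz, zero_mul] at e2
    rw [hz, ← e2] at h0
    norm_num at h0
  refine exists_isCornerCharacter_of_character hp φ hφ hmem' ?_ ?_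
  · rw [← hP1]; congr 2; simp [hp]
  · rw [hP1] at h0
    linear_combination h0

theorem IsCornerCharacter.not_isUnit {p q : B} (hp : p * p = p) {x : ℂ} {f : B →L[ℂ] ℂ}
    (hf : IsCornerCharacter p q x f) : ¬ IsUnit (cornerShift p q x) := by
  rintro ⟨u, hu⟩
  have h1 : f p = 1 := by simpa [hf.map_one] using hf.map_mul_mul 1 1
  have h2 : f (p * q * p) = x := by
    have := hf.map_mul_mul 1 (q * p)
    have h' := hf.map_mul_mul q 1
    simp only [one_mul, mul_one, hf.map_one] at this h'
    rw [mul_assoc, this, h', hf.map_right]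
  have h3 : f (cornerShift p q x) = 0 := by
    simp [cornerShift, h1, h2, hf.map_one]
  have h4 := hf.map_mul_mul (cornerShift p q x) (u⁻¹ : Bˣ)
  have h5 : cornerShift p q x * p = p * cornerShift p q x := by
    simp [cornerShift, mul_add, mul_sub, add_mul, sub_mul, mul_assoc, hp, idem_mul hp]
  rw [h5, mul_assoc, ← hu, Units.mul_inv, mul_one, h1, hu, h3, zero_mul] at h4
  exact one_ne_zero h4

theorem isClosed_cornerSpectrum [CompleteSpace B] (p q : B) :
    IsClosed {x : ℂ | ¬ IsUnit (cornerShift p q x)} :=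
  (nonunits.isClosed (R := B)).preimage (f := cornerShift p q)
    (by unfold cornerShift; fun_prop)

section Ring

variable {R : Type*} [Ring R]

theorem compl_corner {p q : R} (hp : p * p = p) (hq : q * q = q) :
    (1 - p) * q * p * q * (1 - p) = cosSq p q * (1 - cosSq p q) * (1 - p) := by
  simp only [cosSq, mul_add, mul_sub, add_mul, sub_mul, mul_assoc, hp, hq, idem_mul hp,
    idem_mul hq, mul_one, one_mul]
  abel

theorem corner_eq {p q : R} (hp : p * p = p) : p * q * p = cosSq p q * p := by
  simp only [cosSq, add_mul, sub_mul, mul_assoc, hp, one_mul]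
  abel

theorem corner_offDiag {p q : R} (hp : p * p = p) (hq : q * q = q) :
    p * q * (1 - p) * q * p = cosSq p q * (1 - cosSq p q) * p := by
  simp only [cosSq, mul_add, mul_sub, add_mul, sub_mul, mul_assoc, hp, hq, idem_mul hp,
    idem_mul hq, mul_one, one_mul]
  abel

theorem compl_corner_compl {p q : R} (hp : p * p = p) :
    (1 - p) * (1 - q) * (1 - p) = cosSq p q * (1 - p) := by
  simp only [cosSq, mul_sub, add_mul, sub_mul, mul_assoc, hp, mul_one, one_mul]
  abel

end Ring

namespace IsCornerCharacter

variable {p q : B} {x : ℂ} {f : B →L[ℂ] ℂ}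

theorem map_left_mul (hf : IsCornerCharacter p q x f) (b : B) : f (p * b) = f b := by
  simpa [hf.map_one] using hf.map_mul_mul 1 b

theorem map_mul_left (hf : IsCornerCharacter p q x f) (b : B) : f (b * p) = f b := by
  simpa [hf.map_one] using hf.map_mul_mul b 1

theorem map_left (hf : IsCornerCharacter p q x f) : f p = 1 := by
  simpa [hf.map_one] using hf.map_left_mul 1

theorem map_central_mul (hf : IsCornerCharacter p q x f) {z : B}
    (hz : z ∈ Subalgebra.center ℂ B) (b : B) : f (z * b) = f z * f b := by
  rw [← hf.map_mul_mul, ← hf.map_left_mul, ← mul_assoc, Subalgebra.mem_center_iff.1 hz]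

theorem map_cosSq (hf : IsCornerCharacter p q x f) : f (cosSq p q) = x := by
  simp [cosSq, hf.map_left_mul, hf.map_mul_left, hf.map_one, hf.map_left, hf.map_right]

theorem map_cosSq_mul (hf : IsCornerCharacter p q x f)
    (hc : cosSq p q ∈ Subalgebra.center ℂ B) (b : B) : f (cosSq p q * b) = x * f b := by
  rw [hf.map_central_mul hc, hf.map_cosSq]

theorem map_offDiag_mul (hf : IsCornerCharacter p q x f) (hp : p * p = p) (hq : q * q = q)
    (hc : cosSq p q ∈ Subalgebra.center ℂ B) (a b : B) :
    f (a * (1 - p) * q) * f (q * (1 - p) * b) = x * (1 - x) * f (a * (1 - p) * b) := by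
  have hcomm := Subalgebra.mem_center_iff.1
    (Subalgebra.mul_mem _ hc (Subalgebra.sub_mem _ (Subalgebra.one_mem _) hc)) a
  have e : a * (1 - p) * q * p * (q * (1 - p) * b)
      = cosSq p q * ((1 - cosSq p q) * (a * (1 - p) * b)) := by
    calc _ = a * ((1 - p) * q * p * q * (1 - p)) * b := by simp only [mul_assoc]
      _ = _ := by rw [compl_corner hp hq, ← mul_assoc, hcomm]; simp only [mul_assoc]
  rw [← hf.map_mul_mul, e, hf.map_cosSq_mul hc, sub_mul, map_sub, one_mul, hf.map_cosSq_mul hc]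
  ring

theorem map_right_offDiag (hf : IsCornerCharacter p q x f) (hq : q * q = q) :
    f (q * (1 - p) * q) = x * (1 - x) := by
  have : q * (1 - p) * q = q - q * p * q := by simp [mul_sub, sub_mul, hq]
  rw [this, map_sub, hf.map_mul_mul, hf.map_right]
  ring

/-- The linear map underlying the representation attached to a corner character. -/
noncomputable def toMatrix (p q : B) (f : B →L[ℂ] ℂ) (s : ℂ) :
    B →ₗ[ℂ] Matrix (Fin 2) (Fin 2) ℂ where
  toFun b := !![f b, f (b * (1 - p) * q) / s;
    f (q * (1 - p) * b) / s, f (q * (1 - p) * b * (1 - p) * q) / (s * s)]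
  map_add' a b := by
    ext i j
    fin_cases i <;> fin_cases j <;> simp [mul_add, add_mul, add_div]
  map_smul' r b := by
    ext i j
    fin_cases i <;> fin_cases j <;> simp [mul_div_assoc]

theorem toMatrix_apply (p q : B) (f : B →L[ℂ] ℂ) (s : ℂ) (b : B) :
    toMatrix p q f s b = !![f b, f (b * (1 - p) * q) / s;
      f (q * (1 - p) * b) / s, f (q * (1 - p) * b * (1 - p) * q) / (s * s)] := rfl

theorem toMatrix_one (hf : IsCornerCharacter p q x f) (hp : p * p = p) (hq : q * q = q)
    {s : ℂ} (hs : s * s = x * (1 - x)) (hs0 : s ≠ 0) : toMatrix p q f s 1 = 1 := by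
  have h12 : f ((1 - p) * q) = 0 := by
    rw [sub_mul, map_sub, one_mul, hf.map_left_mul, sub_self]
  have h21 : f (q * (1 - p)) = 0 := by
    rw [mul_sub, map_sub, mul_one, hf.map_mul_left, sub_self]
  have e : q * (1 - p) * 1 * (1 - p) * q = q * (1 - p) * q := by
    rw [mul_one, mul_assoc q, compl_idem hp]
  rw [toMatrix_apply, e, one_mul, mul_one, hf.map_one, h12, h21, hf.map_right_offDiag hq, ← hs,
    div_self (mul_ne_zero hs0 hs0), zero_div, Matrix.one_fin_two]

theorem toMatrix_mul (hf : IsCornerCharacter p q x f) (hp : p * p = p) (hq : q * q = q)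
    (hc : cosSq p q ∈ Subalgebra.center ℂ B) {s : ℂ} (hs : s * s = x * (1 - x)) (hs0 : s ≠ 0)
    (a b : B) : toMatrix p q f s (a * b) = toMatrix p q f s a * toMatrix p q f s b := by
  have off : ∀ a b, f (a * (1 - p) * q) * f (q * (1 - p) * b) / (s * s)
      = f (a * (1 - p) * b) := fun a b => by
    rw [hf.map_offDiag_mul hp hq hc, ← hs, mul_div_cancel_left₀ _ (mul_ne_zero hs0 hs0)]
  have split : ∀ a b, f (a * b)
      = f a * f b + f (a * (1 - p) * q) * f (q * (1 - p) * b) / (s * s) := by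
    intro a b
    rw [off, ← hf.map_mul_mul, ← map_add]
    congr 1
    simp [mul_sub, sub_mul]
  simp only [toMatrix_apply, Matrix.mul_fin_two]
  ext i j
  fin_cases i <;> fin_cases j <;>
    simp only [Fin.zero_eta, Fin.isValue, Fin.mk_one, Matrix.of_apply, Matrix.cons_val',
      Matrix.cons_val_zero, Matrix.cons_val_one, Matrix.cons_val_fin_one]
  · rw [split, div_mul_div_comm]
  · have := split a (b * (1 - p) * q)
    simp only [← mul_assoc] at this ⊢
    rw [this]
    field_simp
  · have := split (q * (1 - p) * a) b
    simp only [← mul_assoc] at this ⊢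
    rw [this]
    field_simp
  · have := split (q * (1 - p) * a) (b * (1 - p) * q)
    simp only [← mul_assoc] at this ⊢
    rw [this]
    field_simp

/-- The representation attached to a corner character with `x ≠ 0, 1`. -/
theorem exists_algHom (hf : IsCornerCharacter p q x f) (hp : p * p = p) (hq : q * q = q)
    (hc : cosSq p q ∈ Subalgebra.center ℂ B) {s : ℂ} (hs : s * s = x * (1 - x)) (hs0 : s ≠ 0) :
    ∃ Φ : B →ₐ[ℂ] Matrix (Fin 2) (Fin 2) ℂ, Continuous Φ ∧
      Φ p = !![1, 0; 0, 0] ∧ Φ q = !![x, s; s, 1 - x] := by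
  have hx : x * (1 - x) ≠ 0 := hs ▸ mul_ne_zero hs0 hs0
  refine ⟨AlgHom.ofLinearMap (toMatrix p q f s) (hf.toMatrix_one hp hq hs hs0)
    (hf.toMatrix_mul hp hq hc hs hs0), ?_, ?_, ?_⟩
  · refine continuous_matrix fun i j => ?_
    fin_cases i <;> fin_cases j <;> simp [toMatrix_apply] <;> fun_prop
  · have e1 : p * (1 - p) = 0 := by simp [mul_sub, hp]
    have e2 : q * (1 - p) * p = 0 := by simp [mul_assoc, sub_mul, hp]
    change toMatrix p q f s p = _
    simp only [toMatrix_apply, e1, e2, hf.map_left, zero_mul, map_zero,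
      zero_div]
  · have e : q * (1 - p) * q * (1 - p) * q = q * (1 - p) * q - q * (1 - p) * q * p * q := by
      rw [mul_assoc _ (1 - p) q, sub_mul, one_mul, mul_sub, mul_assoc _ q q, hq,
        ← mul_assoc]
    have e1 : x * (1 - x) / s = s := by rw [← hs, mul_div_cancel_right₀ _ hs0]
    have e2 : (x * (1 - x) - x * (1 - x) * x) / (s * s) = 1 - x := by
      rw [hs, div_eq_iff hx]
      ring
    change toMatrix p q f s q = _
    simp only [toMatrix_apply, e, map_sub, hf.map_mul_mul, hf.map_right,
      hf.map_right_offDiag hq, e1, e2]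

/-- A corner character with `x ∈ {0, 1}` is multiplicative on the whole algebra. -/
theorem map_mul (hf : IsCornerCharacter p q x f) (h : TopGenerates p q) (hp : p * p = p)
    (hq : q * q = q) (hx : x * (1 - x) = 0) (a b : B) : f (a * b) = f a * f b := by
  have split : f (a * b) = f a * f b + f (a * (1 - p) * b) := by
    rw [← hf.map_mul_mul, ← map_add]
    congr 1
    simp [mul_sub, sub_mul]
  have hlow : ∀ b, f (q * (1 - p) * b) = 0 := by
    refine h.mem_of_centralSpan hp hq (T := {b | f (q * (1 - p) * b) = 0})
      (isClosed_eq (by fun_prop) (by fun_prop)) (fun b hb => ?_)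
    obtain ⟨ζ, hζ, e⟩ := exists_lower hp hb
    have : q * (1 - p) * b * p = ζ * (q * (1 - p) * q * p) := by
      have hz := Subalgebra.mem_center_iff.1 hζ q
      calc _ = q * ((1 - p) * b * p) := by simp only [mul_assoc]
        _ = ζ * q * ((1 - p) * q * p) := by rw [e, ← mul_assoc, hz]
        _ = _ := by simp only [mul_assoc]
    change f _ = 0
    rw [← hf.map_mul_left, this, hf.map_central_mul hζ, hf.map_mul_left,
      hf.map_right_offDiag hq, hx, mul_zero]
  have hoff : f (a * (1 - p) * b) = 0 := by
    refine h.mem_of_centralSpan hp hq (T := {a | f (a * (1 - p) * b) = 0})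
      (isClosed_eq (by fun_prop) (by fun_prop)) (fun a ha => ?_) a
    obtain ⟨ζ, hζ, e⟩ := exists_upper (q := q) hp ha
    have : p * (a * (1 - p) * b) = ζ * (p * (q * (1 - p) * b)) := by
      calc _ = (p * a * (1 - p)) * b := by simp only [mul_assoc]
        _ = _ := by rw [e]; simp only [mul_assoc]
    change f _ = 0
    rw [← hf.map_left_mul, this, hf.map_central_mul hζ, hf.map_left_mul, hlow, mul_zero]
  rw [split, hoff, add_zero]

/-- Two complementary corner characters give a diagonal representation when `x ∈ {0, 1}`. -/
theorem exists_algHom_diagonal (hf : IsCornerCharacter p q x f) {g : B →L[ℂ] ℂ}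
    (hg : IsCornerCharacter (1 - p) (1 - q) x g) (h : TopGenerates p q) (hp : p * p = p)
    (hq : q * q = q) (hx : x * (1 - x) = 0) :
    ∃ Φ : B →ₐ[ℂ] Matrix (Fin 2) (Fin 2) ℂ, Continuous Φ ∧
      Φ p = !![1, 0; 0, 0] ∧ Φ q = !![x, 0; 0, 1 - x] := by
  have hfm := hf.map_mul h hp hq hx
  have hgm := hg.map_mul h.compl (compl_idem hp) (compl_idem hq) hx
  have hgp : g p = 0 := by
    have := hg.map_left
    rw [map_sub, hg.map_one] at this
    linear_combination -this
  have hgq : g q = 1 - x := by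
    have := hg.map_right
    rw [map_sub, hg.map_one] at this
    linear_combination -this
  let F : B →ₗ[ℂ] Matrix (Fin 2) (Fin 2) ℂ :=
    { toFun := fun b => !![f b, 0; 0, g b]
      map_add' := fun a b => by ext i j; fin_cases i <;> fin_cases j <;> simp
      map_smul' := fun r b => by ext i j; fin_cases i <;> fin_cases j <;> simp }
  refine ⟨AlgHom.ofLinearMap F ?_ ?_, ?_, ?_, ?_⟩
  · ext i j; fin_cases i <;> fin_cases j <;> simp [F, hf.map_one, hg.map_one]
  · intro a b
    ext i j
    fin_cases i <;> fin_cases j <;> simp [F, Matrix.mul_apply, hfm, hgm]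
  · refine continuous_matrix fun i j => ?_
    fin_cases i <;> fin_cases j <;> simp [F] <;> fun_prop
  · simp [F, hf.map_left, hgp]
  · simp [F, hf.map_right, hgq]

/-- Transfer of a corner character with `x ≠ 0, 1` to the complementary corner. -/
theorem exists_compl (hf : IsCornerCharacter p q x f) (hp : p * p = p) (hq : q * q = q)
    (hc : cosSq p q ∈ Subalgebra.center ℂ B) (hx : x * (1 - x) ≠ 0) :
    ∃ g, IsCornerCharacter (1 - p) (1 - q) x g := by
  have key : ∀ a, f (q * (1 - p) * (a * (1 - p) * q)) = f (q * (1 - p) * a * (1 - p) * q) :=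
    fun a => by simp only [mul_assoc]
  have hone : f (q * (1 - p) * 1 * (1 - p) * q) = x * (1 - x) := by
    rw [mul_one, mul_assoc q, compl_idem hp, hf.map_right_offDiag hq]
  refine ⟨{ toFun := fun b => f (q * (1 - p) * b * (1 - p) * q) / (x * (1 - x))
            map_add' := fun a b => by simp [mul_add, add_mul, add_div]
            map_smul' := fun r b => by simp [mul_div_assoc]
            cont := by fun_prop }, ?_, ?_, fun a b => ?_⟩
  · change f _ / _ = 1
    rw [hone, div_self hx]
  · change f _ / _ = x
    have e : q * (1 - p) * (1 - q) * (1 - p) * q = cosSq p q * (q * (1 - p) * q) := by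
      calc _ = q * ((1 - p) * (1 - q) * (1 - p)) * q := by simp only [mul_assoc]
        _ = _ := by
          rw [compl_corner_compl hp, ← mul_assoc q, Subalgebra.mem_center_iff.1 hc]
          simp only [mul_assoc]
    rw [e, hf.map_cosSq_mul hc, hf.map_right_offDiag hq, mul_div_cancel_right₀ _ hx]
  · change f _ / _ = f _ / _ * (f _ / _)
    have := hf.map_offDiag_mul hp hq hc (q * (1 - p) * a) (b * (1 - p) * q)
    simp only [← mul_assoc] at this ⊢
    rw [div_mul_div_comm, this, mul_div_mul_left _ _ hx]

end IsCornerCharacter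

theorem exists_one_sub_mul_mem {R : Type*} [Ring R] {L : Ideal R} (hL : L.IsMaximal) {y : R}
    (hy : y ∉ L) : ∃ a, 1 - a * y ∈ L := by
  have htop : L ⊔ Ideal.span {y} = ⊤ := hL.1.2 _ <|
    lt_of_le_of_ne le_sup_left fun h => hy <| h ▸
      (le_sup_right : Ideal.span {y} ≤ L ⊔ Ideal.span {y}) (Ideal.mem_span_singleton_self y)
  obtain ⟨l, hl, m, hm, hlm⟩ := Submodule.mem_sup.1 (htop ▸ Submodule.mem_top : (1 : R) ∈ _)
  obtain ⟨a, rfl⟩ := Ideal.mem_span_singleton'.1 hm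
  exact ⟨a, by rw [← hlm]; simpa using hl⟩

/-- Central elements act as scalars modulo a maximal left ideal (Schur and Gelfand-Mazur). -/
theorem exists_sub_algebraMap_mem [CompleteSpace B] {L : Ideal B} (hL : L.IsMaximal) {z : B}
    (hz : ∀ b, b * z = z * b) : ∃ μ : ℂ, z - algebraMap ℂ B μ ∈ L := by
  let S : Submodule ℂ B := L.restrictScalars ℂ
  have hS : IsClosed (S : Set B) := Ideal.IsMaximal.isClosed (I := L)
  have hzS : ∀ b ∈ S, z * b ∈ S := fun b hb => L.mul_mem_left z hb
  let T : (B ⧸ S) →L[ℂ] (B ⧸ S) := S.liftQL (S.mkQL ∘L ContinuousLinearMap.mul ℂ B z)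
    (fun b hb => by simpa using hzS b hb)
  have hT : ∀ b : B, T (S.mkQ b) = S.mkQ (z * b) := fun b => by simp [T]
  have : Nontrivial (B ⧸ S) := by
    refine Submodule.Quotient.nontrivial_iff.2 fun h => hL.ne_top ?_
    rw [Ideal.eq_top_iff_one]
    exact (h ▸ Submodule.mem_top : (1 : B) ∈ S)
  obtain ⟨μ, hμ⟩ := spectrum.nonempty T
  refine ⟨μ, ?_⟩
  by_contra hw
  set w := z - algebraMap ℂ B μ with hwdef
  have hwc : ∀ b, b * w = w * b := fun b => by
    rw [hwdef, mul_sub, sub_mul, hz, Algebra.commutes]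
  have hTw : ∀ b : B, (algebraMap ℂ _ μ - T) (S.mkQ b) = - S.mkQ (w * b) := fun b => by
    rw [sub_apply, hT, hwdef, sub_mul, map_sub]
    simp [Algebra.algebraMap_eq_smul_one]
  obtain ⟨a, ha⟩ := exists_one_sub_mul_mem hL hw
  refine hμ (ContinuousLinearMap.isUnit_iff_bijective.2 ⟨?_, ?_⟩)
  · rw [injective_iff_map_eq_zero]
    intro v hv
    obtain ⟨b, rfl⟩ := S.mkQ_surjective v
    rw [hTw, neg_eq_zero, Submodule.mkQ_apply, Submodule.Quotient.mk_eq_zero] at hv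
    let N : Ideal B := Submodule.comap (LinearMap.toSpanSingleton B B w) L
    have hN : L = N := by
      refine hL.eq_of_le (fun h => hw ?_) (fun y hy => ?_)
      · have : (1 : B) ∈ N := h ▸ Submodule.mem_top
        simpa [N] using this
      · change y * w ∈ L
        rw [hwc]
        exact L.mul_mem_left _ hy
    have : b ∈ N := by
      change b * w ∈ L
      rw [hwc]
      exact hv
    rw [Submodule.mkQ_apply, Submodule.Quotient.mk_eq_zero]
    exact (hN ▸ this : b ∈ L)
  · intro v
    obtain ⟨b, rfl⟩ := S.mkQ_surjective v
    refine ⟨S.mkQ (-(b * a)), ?_⟩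
    rw [hTw, mul_neg, map_neg, neg_neg, ← sub_eq_zero, ← map_sub, Submodule.mkQ_apply,
      Submodule.Quotient.mk_eq_zero, ← hwc, ← neg_mem_iff]
    have := L.mul_mem_left b ha
    rw [mul_sub, mul_one, ← mul_assoc] at this
    simpa using! this

theorem not_isUnit_cornerShift {p q : B} (hp : p * p = p) {x : ℂ} (hx : x ≠ 0)
    (h : x ∈ spectrum ℂ (p * q * p)) : ¬ IsUnit (cornerShift p q x) := by
  intro hu
  have hv : ∀ {y : ℂ}, y ≠ 0 → (p - y • (1 - p)) * (p - y⁻¹ • (1 - p)) = 1 := fun hy => by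
    simp [mul_sub, sub_mul, hp, smul_smul, hy]
  have hv' : IsUnit (p - x • (1 - p)) := by
    refine ⟨⟨_, _, hv hx, ?_⟩, rfl⟩
    simpa using hv (inv_ne_zero hx)
  refine h ?_
  have e : algebraMap ℂ B x - p * q * p = -(cornerShift p q x * (p - x • (1 - p))) := by
    simp [cornerShift, mul_sub, sub_mul, add_mul, mul_assoc, hp, Algebra.algebraMap_eq_smul_one]
    module
  change IsUnit (algebraMap ℂ B x - p * q * p)
  rw [e]
  exact (hu.mul hv').neg

theorem mem_closure_diff_pair {S : Set ℂ} {x y : ℂ} (hxy : x ≠ y) (h : x ∈ closure (S \ {x})) :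
    x ∈ closure {z | z ∈ S ∧ z ≠ x ∧ z ≠ y} := by
  refine closure_mono ?_ (isOpen_compl_singleton.inter_closure ⟨hxy, h⟩)
  rintro z ⟨h1, h2, h3⟩
  exact ⟨h2, h3, h1⟩

theorem TopGenerates.exists_isCornerCharacter_pair [CompleteSpace B] {p q : B}
    (h : TopGenerates p q) (hp : p * p = p) (hq : q * q = q)
    (h0 : (0 : ℂ) ∈ closure (spectrum ℂ (p * q * p) \ {0}))
    (h1 : (1 : ℂ) ∈ closure (spectrum ℂ (p * q * p) \ {1}))
    {x : ℂ} (hx : x ∈ spectrum ℂ (p * q * p)) :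
    (∃ f, IsCornerCharacter p q x f) ∧ ∃ g, IsCornerCharacter (1 - p) (1 - q) x g := by
  have hne : ∀ x ∈ spectrum ℂ (p * q * p), x ≠ 0 → ¬ IsUnit (cornerShift p q x) :=
    fun x hx hx0 => not_isUnit_cornerShift hp hx0 hx
  have hgen : ∀ x ∈ spectrum ℂ (p * q * p), x ≠ 0 → x ≠ 1 →
      ¬ IsUnit (cornerShift (1 - p) (1 - q) x) := by
    intro x hx hx0 hx1
    obtain ⟨f, hf⟩ := h.exists_isCornerCharacter hp hq (hne x hx hx0)
    obtain ⟨g, hg⟩ := hf.exists_compl hp hq (h.center hp hq)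
      (mul_ne_zero hx0 (sub_ne_zero.2 hx1.symm))
    exact hg.not_isUnit (compl_idem hp)
  constructor
  · refine h.exists_isCornerCharacter hp hq ?_
    by_cases hx0 : x = 0
    · subst hx0
      exact closure_minimal (fun z hz => hne z hz.1 hz.2) (isClosed_cornerSpectrum p q) h0
    · exact hne x hx hx0
  · refine h.compl.exists_isCornerCharacter (compl_idem hp) (compl_idem hq) ?_
    have hcl := isClosed_cornerSpectrum (1 - p) (1 - q)
    by_cases hx0 : x = 0
    · subst hx0
      exact closure_minimal (fun z hz => hgen z hz.1 hz.2.1 hz.2.2) hcl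
        (mem_closure_diff_pair zero_ne_one h0)
    by_cases hx1 : x = 1
    · subst hx1
      exact closure_minimal (fun z hz => hgen z hz.1 hz.2.2 hz.2.1) hcl
        (mem_closure_diff_pair one_ne_zero h1)
    · exact hgen x hx hx0 hx1

theorem TopGenerates.exists_algHom [CompleteSpace B] {p q : B}
    (h : TopGenerates p q) (hp : p * p = p) (hq : q * q = q)
    (h0 : (0 : ℂ) ∈ closure (spectrum ℂ (p * q * p) \ {0}))
    (h1 : (1 : ℂ) ∈ closure (spectrum ℂ (p * q * p) \ {1}))
    {x : ℂ} (hx : x ∈ spectrum ℂ (p * q * p)) {s : ℂ} (hs : s * s = x * (1 - x)) :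
    ∃ Φ : B →ₐ[ℂ] Matrix (Fin 2) (Fin 2) ℂ, Continuous Φ ∧
      Φ p = !![1, 0; 0, 0] ∧ Φ q = !![x, s; s, 1 - x] := by
  obtain ⟨⟨f, hf⟩, g, hg⟩ := h.exists_isCornerCharacter_pair hp hq h0 h1 hx
  by_cases hs0 : s = 0
  · subst hs0
    exact hf.exists_algHom_diagonal hg h hp hq (by rw [← hs, zero_mul])
  · exact hf.exists_algHom hp hq (h.center hp hq) hs hs0

theorem smul_mem_ideal (L : Ideal B) (r : ℂ) {b : B} (hb : b ∈ L) : r • b ∈ L :=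
  (L.restrictScalars ℂ).smul_mem r hb

theorem mem_spectrum_of_cosSq_sub_mem {p q : B} (hp : p * p = p) (hq : q * q = q)
    (hc : ∀ b, b * cosSq p q = cosSq p q * b) {L : Ideal B} (hL : L ≠ ⊤) {x : ℂ}
    (hx : cosSq p q - algebraMap ℂ B x ∈ L) (hx0 : x ≠ 0) (hx1 : x ≠ 1) :
    x ∈ spectrum ℂ (p * q * p) := by
  intro hu
  obtain ⟨u, hu⟩ : IsUnit (algebraMap ℂ B x - p * q * p) := hu
  have key : ∀ y, p * y ∈ L := by
    intro y
    have e : p * y = -((u⁻¹ : Bˣ) * (p * y) * (cosSq p q - algebraMap ℂ B x)) := by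
      have e1 : p * y * (cosSq p q - algebraMap ℂ B x) = -(u * (p * y)) := by
        rw [hu, mul_sub, hc, ← Algebra.commutes, ← mul_assoc, ← corner_eq hp]
        simp [sub_mul, mul_assoc, idem_mul hp]
      rw [mul_assoc, e1, mul_neg, neg_neg, Units.inv_mul_cancel_left]
    rw [e]
    exact L.neg_mem (L.mul_mem_left _ hx)
  have hpL : p ∈ L := by simpa using key 1
  have hqL : q ∈ L := by
    have e : q = x⁻¹ • (q * (p * q) - q * (cosSq p q - algebraMap ℂ B x)) := by
      have : q * cosSq p q = q * (p * q) := by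
        simp [cosSq, mul_add, mul_sub, hq, idem_mul hq]
      rw [mul_sub, this, ← Algebra.commutes, sub_sub_cancel, ← Algebra.smul_def, smul_smul,
        inv_mul_cancel₀ hx0, one_smul]
    rw [e]
    exact smul_mem_ideal L _ (L.sub_mem (L.mul_mem_left _ (key q)) (L.mul_mem_left _ hx))
  refine hL ((Ideal.eq_top_iff_one L).2 ?_)
  have e : (1 : B) = (1 - x)⁻¹ • ((cosSq p q - algebraMap ℂ B x) + p + q - p * q - q * p) := by
    have : (cosSq p q - algebraMap ℂ B x) + p + q - p * q - q * p = (1 - x) • (1 : B) := by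
      rw [cosSq, Algebra.algebraMap_eq_smul_one]
      module
    rw [this, smul_smul, inv_mul_cancel₀ (sub_ne_zero.2 hx1.symm), one_smul]
  rw [e]
  exact smul_mem_ideal L _ (L.sub_mem (L.sub_mem (L.add_mem (L.add_mem hx hpL) hqL) (key q))
    (L.mul_mem_left _ hpL))

theorem mem_of_mul_mul_self_mem {R : Type*} [Ring R] {L : Ideal R} (hL : L.IsMaximal) {n : R}
    (hn : ∀ y, n * y * n ∈ L) : n ∈ L := by
  by_contra h
  obtain ⟨a, ha⟩ := exists_one_sub_mul_mem hL h
  refine h ?_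
  have := L.add_mem (L.mul_mem_left n ha) (hn a)
  rwa [mul_sub, mul_one, ← mul_assoc, sub_add_cancel] at this

theorem TopGenerates.upper_mem [CompleteSpace B] {p q : B} (h : TopGenerates p q)
    (hp : p * p = p) (hq : q * q = q) {L : Ideal B} (hL : L.IsMaximal) {x : ℂ}
    (hx : cosSq p q - algebraMap ℂ B x ∈ L) (hx01 : x * (1 - x) = 0) :
    p * q * (1 - p) ∈ L := by
  have hcl : IsClosed (L : Set B) := Ideal.IsMaximal.isClosed (I := L)
  have hc := h.cosSq_central hp hq
  have hcc : ∀ y, y * (cosSq p q * (1 - cosSq p q)) ∈ L := by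
    intro y
    have e : cosSq p q * (1 - cosSq p q)
        = (1 - cosSq p q - algebraMap ℂ B x) * (cosSq p q - algebraMap ℂ B x) := by
      have : algebraMap ℂ B x * algebraMap ℂ B x = algebraMap ℂ B x := by
        rw [← map_mul]
        congr 1
        linear_combination -hx01
      simp only [mul_sub, sub_mul, this, ← Algebra.commutes x, one_mul, mul_one]
      abel
    rw [e]
    exact L.mul_mem_left _ (L.mul_mem_left _ hx)
  refine mem_of_mul_mul_self_mem hL fun y => ?_
  refine h.mem_of_centralSpan hp hq (T := {y | p * q * (1 - p) * y * (p * q * (1 - p)) ∈ L})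
    (hcl.preimage (by fun_prop)) (fun y hy => ?_) y
  obtain ⟨ζ, hζ, e⟩ := exists_lower hp hy
  have hccomm : ∀ b, b * (cosSq p q * (1 - cosSq p q)) = cosSq p q * (1 - cosSq p q) * b := by
    have := h.center hp hq
    exact Subalgebra.mem_center_iff.1
      (Subalgebra.mul_mem _ this (Subalgebra.sub_mem _ (Subalgebra.one_mem _) this))
  have hζ' := Subalgebra.mem_center_iff.1 hζ (p * q)
  have : p * q * (1 - p) * y * (p * q * (1 - p))
      = ζ * (p * q * (1 - p)) * (cosSq p q * (1 - cosSq p q)) := by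
    calc _ = p * q * ((1 - p) * y * p) * (q * (1 - p)) := by simp only [mul_assoc]
      _ = p * q * ζ * ((1 - p) * q * p) * (q * (1 - p)) := by rw [e]; simp only [mul_assoc]
      _ = ζ * (p * q * (1 - p) * q * p) * (q * (1 - p)) := by rw [hζ']; simp only [mul_assoc]
      _ = ζ * (cosSq p q * (1 - cosSq p q) * (p * (q * (1 - p)))) := by
        rw [corner_offDiag hp hq]; simp only [mul_assoc]
      _ = _ := by rw [← hccomm]; simp only [mul_assoc]
  change _ ∈ L
  rw [this]
  exact hcc _

theorem TopGenerates.sub_mem_of_cosSq_sub_mem [CompleteSpace B] {p q : B} (h : TopGenerates p q)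
    (hp : p * p = p) (hq : q * q = q) {L : Ideal B} (hL : L.IsMaximal) {x : ℂ}
    (hx : cosSq p q - algebraMap ℂ B x ∈ L) (hx01 : x * (1 - x) = 0) :
    (1 - p ∈ L ∧ q - algebraMap ℂ B x ∈ L) ∨ (p ∈ L ∧ q - algebraMap ℂ B (1 - x) ∈ L) := by
  have hcl : IsClosed (L : Set B) := Ideal.IsMaximal.isClosed (I := L)
  have hc := h.cosSq_central hp hq
  have hup := h.upper_mem hp hq hL hx hx01
  have hlow : (1 - p) * q * p ∈ L := by
    have := h.compl.upper_mem (compl_idem hp) (compl_idem hq) hL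
      (by rwa [cosSq_compl]) hx01
    have e : (1 - p) * (1 - q) * (1 - (1 - p)) = -((1 - p) * q * p) := by
      simp only [mul_sub, sub_mul, mul_one, one_mul, hp, sub_sub_cancel]
      abel
    rw [e] at this
    exact neg_mem_iff.1 this
  have hsplit : q = cosSq p q * p + p * q * (1 - p) + (1 - p) * q * p
      + (1 - cosSq p q) * (1 - p) := by
    simp only [cosSq, mul_sub, add_mul, sub_mul, mul_assoc, hp, mul_one, one_mul]
    abel
  by_cases hpL : p ∈ L
  · right
    refine ⟨hpL, ?_⟩
    have e : q - algebraMap ℂ B (1 - x)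
        = cosSq p q * p + p * q * (1 - p) + (1 - p) * q * p
          - (1 - cosSq p q) * p - (cosSq p q - algebraMap ℂ B x) := by
      conv_lhs => rw [hsplit]
      rw [map_sub, map_one, mul_sub (1 - cosSq p q), mul_one]
      abel
    rw [e]
    exact L.sub_mem (L.sub_mem (L.add_mem (L.add_mem (L.mul_mem_left _ hpL) hup) hlow)
      (L.mul_mem_left _ hpL)) hx
  · left
    have hall : ∀ y, (1 - p) * y * p ∈ L := by
      refine h.mem_of_centralSpan hp hq (T := {y | (1 - p) * y * p ∈ L})
        (hcl.preimage (by fun_prop)) (fun y hy => ?_)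
      obtain ⟨ζ, -, e⟩ := exists_lower hp hy
      change _ ∈ L
      rw [e]
      exact L.mul_mem_left _ hlow
    obtain ⟨a, ha⟩ := exists_one_sub_mul_mem hL hpL
    have hpc : 1 - p ∈ L := by
      have := L.add_mem (L.mul_mem_left (1 - p) ha) (hall a)
      rwa [mul_sub, mul_one, ← mul_assoc, sub_add_cancel] at this
    refine ⟨hpc, ?_⟩
    have e : q - algebraMap ℂ B x
        = (cosSq p q - algebraMap ℂ B x) - cosSq p q * (1 - p) + p * q * (1 - p)
          + (1 - p) * q * p + (1 - cosSq p q) * (1 - p) := by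
      conv_lhs => rw [hsplit]
      rw [mul_sub (cosSq p q), mul_one]
      abel
    rw [e]
    exact L.add_mem (L.add_mem (L.add_mem (L.sub_mem hx (L.mul_mem_left _ hpc)) hup) hlow)
      (L.mul_mem_left _ hpc)

theorem TopGenerates.diagonal_not_isUnit {p q : B} (h : TopGenerates p q)
    {L : Ideal B} (hL : L ≠ ⊤) (hcl : IsClosed (L : Set B))
    (Φ : B →ₐ[ℂ] Matrix (Fin 2) (Fin 2) ℂ) (hΦ : Continuous Φ) {d e : Fin 2 → ℂ}
    (hp : Φ p = Matrix.diagonal d) (hq : Φ q = Matrix.diagonal e) (i : Fin 2)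
    (hpL : p - algebraMap ℂ B (d i) ∈ L) (hqL : q - algebraMap ℂ B (e i) ∈ L)
    {b : B} (hb : b ∈ L) : ¬ IsUnit (Φ b) := by
  have hent : ∀ i j, Continuous fun b => Φ b i j := fun i j => hΦ.matrix_elem i j
  have hoff : ∀ j, j ≠ i → ∀ b, Φ b i j = 0 := by
    intro j hj
    let S : Submodule ℂ B := LinearMap.ker
      ((Matrix.entryLinearMap ℂ ℂ i j).comp Φ.toLinearMap)
    refine h S (isClosed_eq (hent i j) continuous_const) ?_ ?_ ?_
    · simp [S, hj.symm]
    · intro b hb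
      have hb : Φ b i j = 0 := hb
      simp [S, hp, Matrix.diagonal_mul, hb]
    · intro b hb
      have hb : Φ b i j = 0 := hb
      simp [S, hq, Matrix.diagonal_mul, hb]
  have hdiag : ∀ b, b - algebraMap ℂ B (Φ b i i) ∈ L := by
    let S : Submodule ℂ B := (L.restrictScalars ℂ).comap (LinearMap.id -
      (Algebra.linearMap ℂ B).comp ((Matrix.entryLinearMap ℂ ℂ i i).comp Φ.toLinearMap))
    have step : ∀ (u : B) (d : Fin 2 → ℂ), Φ u = Matrix.diagonal d →
        u - algebraMap ℂ B (d i) ∈ L → ∀ b, b - algebraMap ℂ B (Φ b i i) ∈ L →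
        u * b - algebraMap ℂ B (Φ (u * b) i i) ∈ L := by
      intro u d hu huL b hb
      have : u * b - algebraMap ℂ B (Φ (u * b) i i) = u * (b - algebraMap ℂ B (Φ b i i))
          + algebraMap ℂ B (Φ b i i) * (u - algebraMap ℂ B (d i)) := by
        rw [map_mul, hu, Matrix.diagonal_mul, mul_comm (d i), map_mul, mul_sub, mul_sub,
          Algebra.commutes _ u, sub_add_sub_cancel]
      rw [this]
      exact L.add_mem (L.mul_mem_left _ hb) (L.mul_mem_left _ huL)
    refine h S (hcl.preimage (f := fun b => b - algebraMap ℂ B (Φ b i i)) ?_) ?_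
      (step p d hp hpL) (step q e hq hqL)
    · exact continuous_id.sub ((algebraMapCLM ℂ B).continuous.comp (hent i i))
    · simp [S]
  have hzero : Φ b i i = 0 := by
    by_contra hne
    refine hL ((Ideal.eq_top_iff_one L).2 ?_)
    have := smul_mem_ideal L (Φ b i i)⁻¹ (L.sub_mem hb (hdiag b))
    rwa [sub_sub_cancel, Algebra.algebraMap_eq_smul_one, smul_smul, inv_mul_cancel₀ hne,
      one_smul] at this
  intro hu
  have hdet : (Φ b).det = 0 := Matrix.det_eq_zero_of_row_eq_zero i fun j => by
    by_cases hj : j = i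
    · rw [hj, hzero]
    · exact hoff j hj b
  exact ((Matrix.isUnit_iff_isUnit_det _).1 hu).ne_zero hdet

/-- The linear section of the representation with parameters `x` and `s ≠ 0`. -/
noncomputable def matrixSection (p q : B) (x s : ℂ) : Matrix (Fin 2) (Fin 2) ℂ →ₗ[ℂ] B where
  toFun m := (m 1 1 - m 1 0 / s * (1 - x)) • (1 : B)
    + (m 0 0 - m 1 1 + m 1 0 / s * (1 - x) - m 0 1 / s * x) • p
    + (m 1 0 / s) • q + ((m 0 1 - m 1 0) / s) • (p * q)
  map_add' m n := by
    simp only [Matrix.add_apply]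
    module
  map_smul' r m := by
    simp only [Matrix.smul_apply, smul_eq_mul, RingHom.id_apply]
    module

theorem matrixSection_apply (p q : B) (x s : ℂ) (m : Matrix (Fin 2) (Fin 2) ℂ) :
    matrixSection p q x s m = (m 1 1 - m 1 0 / s * (1 - x)) • (1 : B)
      + (m 0 0 - m 1 1 + m 1 0 / s * (1 - x) - m 0 1 / s * x) • p
      + (m 1 0 / s) • q + ((m 0 1 - m 1 0) / s) • (p * q) := rfl

theorem map_matrixSection {p q : B} {x s : ℂ} (hs0 : s ≠ 0)
    {Φ : B →ₐ[ℂ] Matrix (Fin 2) (Fin 2) ℂ} (hΦp : Φ p = !![1, 0; 0, 0])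
    (hΦq : Φ q = !![x, s; s, 1 - x]) (m : Matrix (Fin 2) (Fin 2) ℂ) :
    Φ (matrixSection p q x s m) = m := by
  rw [matrixSection_apply]
  simp only [map_add, map_smul, map_mul, map_one, hΦp, hΦq, Matrix.one_fin_two,
    Matrix.mul_fin_two]
  ext i j
  fin_cases i <;> fin_cases j <;> simp <;> field_simp <;> ring

theorem mul_matrixSection_left {p q : B} (hp : p * p = p) {x s : ℂ}
    (m : Matrix (Fin 2) (Fin 2) ℂ) :
    p * matrixSection p q x s m = matrixSection p q x s (!![1, 0; 0, 0] * m) := by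
  simp only [matrixSection_apply, mul_add, mul_smul_comm, mul_one, hp, idem_mul hp,
    Matrix.mul_apply, Fin.sum_univ_two, Matrix.of_apply, Matrix.cons_val', Matrix.cons_val_zero,
    Matrix.cons_val_one, Matrix.cons_val_fin_one]
  module

theorem mul_matrixSection_right {p q : B} (hq : q * q = q) {x s : ℂ} (hs0 : s ≠ 0)
    (hs : s * s = x * (1 - x)) (m : Matrix (Fin 2) (Fin 2) ℂ) :
    q * matrixSection p q x s m = matrixSection p q x s (!![x, s; s, 1 - x] * m)
      + (m 0 0 - m 1 1 + m 1 0 / s * (1 - x) - m 0 1 / s * x) • (cosSq p q - algebraMap ℂ B x)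
      + ((m 0 1 - m 1 0) / s) • (q * (cosSq p q - algebraMap ℂ B x)) := by
  obtain ⟨u, hu⟩ : ∃ u, m 1 0 = s * u := ⟨m 1 0 / s, by field_simp⟩
  obtain ⟨v, hv⟩ : ∃ v, m 0 1 = s * v := ⟨m 0 1 / s, by field_simp⟩
  have e1 : ∀ w, s * w / s = w := fun w => by field_simp
  have e2 : ∀ w, (s * w + (1 - x) * (s * u)) / s = w + (1 - x) * u := fun w => by field_simp
  have e3 : ∀ w, (x * (s * v) + s * w) / s = x * v + w := fun w => by field_simp
  have e4 : (s * v - s * u) / s = v - u := by field_simp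
  have e5 : ∀ w z, (x * (s * v) + s * w - (s * z + (1 - x) * (s * u))) / s
      = x * v + w - (z + (1 - x) * u) := fun w z => by field_simp
  have e6 : ∀ w, s * (s * w) = x * (1 - x) * w := fun w => by rw [← mul_assoc, hs]
  have hqc : q * cosSq p q = q * (p * q) := by
    simp [cosSq, mul_add, mul_sub, hq, idem_mul hq]
  simp only [matrixSection_apply, mul_add, mul_smul_comm, mul_one, hq, mul_sub, hqc,
    Matrix.mul_apply, Fin.sum_univ_two, Matrix.of_apply, Matrix.cons_val', Matrix.cons_val_zero,
    Matrix.cons_val_one, Matrix.cons_val_fin_one, hu, hv, e1, e2, e3, e4, e5, e6,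
    Algebra.algebraMap_eq_smul_one]
  rw [cosSq]
  module

theorem TopGenerates.sub_matrixSection_mem {p q : B} (h : TopGenerates p q) (hp : p * p = p)
    (hq : q * q = q) {x s : ℂ} (hs0 : s ≠ 0) (hs : s * s = x * (1 - x))
    {Φ : B →ₐ[ℂ] Matrix (Fin 2) (Fin 2) ℂ} (hΦ : Continuous Φ) (hΦp : Φ p = !![1, 0; 0, 0])
    (hΦq : Φ q = !![x, s; s, 1 - x]) {L : Ideal B} (hcl : IsClosed (L : Set B))
    (hx : cosSq p q - algebraMap ℂ B x ∈ L) (b : B) :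
    b - matrixSection p q x s (Φ b) ∈ L := by
  let S : Submodule ℂ B := (L.restrictScalars ℂ).comap
    (LinearMap.id - (matrixSection p q x s).comp Φ.toLinearMap)
  refine h S (hcl.preimage (f := fun b => b - matrixSection p q x s (Φ b)) ?_) ?_ ?_ ?_ b
  · have hent : ∀ i j, Continuous fun b => Φ b i j := fun i j => hΦ.matrix_elem i j
    have h00 := hent 0 0
    have h01 := hent 0 1
    have h10 := hent 1 0
    have h11 := hent 1 1
    simp only [matrixSection_apply]
    fun_prop
  · change 1 - matrixSection p q x s (Φ 1) ∈ L
    have : matrixSection p q x s (Φ 1) = 1 := by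
      simp [matrixSection_apply]
    rw [this, sub_self]
    exact L.zero_mem
  · intro b hb
    change b - matrixSection p q x s (Φ b) ∈ L at hb
    change p * b - matrixSection p q x s (Φ (p * b)) ∈ L
    rw [map_mul, hΦp, ← mul_matrixSection_left hp, ← mul_sub]
    exact L.mul_mem_left _ hb
  · intro b hb
    change b - matrixSection p q x s (Φ b) ∈ L at hb
    change q * b - matrixSection p q x s (Φ (q * b)) ∈ L
    have e := mul_matrixSection_right (p := p) hq hs0 hs (Φ b)
    rw [add_assoc, ← sub_eq_iff_eq_add'] at e
    rw [map_mul, hΦq, ← sub_add_sub_cancel _ (q * matrixSection p q x s (Φ b)), e, ← mul_sub]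
    exact L.add_mem (L.mul_mem_left _ hb)
      (L.add_mem (smul_mem_ideal L _ hx) (smul_mem_ideal L _ (L.mul_mem_left _ hx)))

theorem TopGenerates.exists_left_inverse [CompleteSpace B] {p q : B} (h : TopGenerates p q)
    (hp : p * p = p) (hq : q * q = q) (h0 : 0 ∈ spectrum ℂ (p * q * p))
    (h1 : 1 ∈ spectrum ℂ (p * q * p)) (h0' : (0 : ℂ) ∈ closure (spectrum ℂ (p * q * p) \ {0}))
    (h1' : (1 : ℂ) ∈ closure (spectrum ℂ (p * q * p) \ {1})) {b : B}
    (hb : ∀ x ∈ spectrum ℂ (p * q * p), ∀ Φ : B →ₐ[ℂ] Matrix (Fin 2) (Fin 2) ℂ, Continuous Φ →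
      Φ p = !![1, 0; 0, 0] → (∃ s : ℂ, s * s = x * (1 - x) ∧ Φ q = !![x, s; s, 1 - x]) →
      IsUnit (Φ b)) : ∃ a, a * b = 1 := by
  by_contra hna
  have hne : Ideal.span {b} ≠ ⊤ := fun htop =>
    hna (Ideal.mem_span_singleton'.1 ((Ideal.eq_top_iff_one _).1 htop))
  obtain ⟨L, hL, hle⟩ := Ideal.exists_le_maximal _ hne
  have hbL : b ∈ L := hle (Ideal.mem_span_singleton_self b)
  have hcl : IsClosed (L : Set B) := Ideal.IsMaximal.isClosed (I := L)
  obtain ⟨x, hx⟩ := exists_sub_algebraMap_mem hL (h.cosSq_central hp hq)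
  by_cases hx01 : x * (1 - x) = 0
  · have hxs : x ∈ spectrum ℂ (p * q * p) := by
      rcases mul_eq_zero.1 hx01 with h | h
      · rwa [h]
      · rwa [← sub_eq_zero.1 h]
    have hs : (0 : ℂ) * 0 = x * (1 - x) := by rw [hx01, mul_zero]
    obtain ⟨Φ, hΦ, hΦp, hΦq⟩ := h.exists_algHom hp hq h0' h1' hxs hs
    have hu := hb x hxs Φ hΦ hΦp ⟨0, hs, hΦq⟩
    have hdp : Φ p = Matrix.diagonal ![1, 0] := by
      rw [hΦp]; ext i j; fin_cases i <;> fin_cases j <;> simp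
    have hdq : Φ q = Matrix.diagonal ![x, 1 - x] := by
      rw [hΦq]; ext i j; fin_cases i <;> fin_cases j <;> simp
    rcases h.sub_mem_of_cosSq_sub_mem hp hq hL hx hx01 with ⟨hpL, hqL⟩ | ⟨hpL, hqL⟩
    · refine h.diagonal_not_isUnit hL.ne_top hcl Φ hΦ hdp hdq 0 ?_ hqL hbL hu
      simpa using L.neg_mem hpL
    · refine h.diagonal_not_isUnit hL.ne_top hcl Φ hΦ hdp hdq 1 ?_ hqL hbL hu
      simpa using hpL
  · have hx0 : x ≠ 0 := left_ne_zero_of_mul hx01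
    have hx1 : x ≠ 1 := (sub_ne_zero.1 (right_ne_zero_of_mul hx01)).symm
    have hxs := mem_spectrum_of_cosSq_sub_mem hp hq (h.cosSq_central hp hq) hL.ne_top hx hx0 hx1
    obtain ⟨s, hs⟩ := IsAlgClosed.exists_pow_nat_eq (x * (1 - x)) two_pos
    rw [sq] at hs
    have hs0 : s ≠ 0 := by
      rintro rfl
      exact hx01 (by rw [← hs, mul_zero])
    obtain ⟨Φ, hΦ, hΦp, hΦq⟩ := h.exists_algHom hp hq h0' h1' hxs hs
    have hu := hb x hxs Φ hΦ hΦp ⟨s, hs, hΦq⟩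
    have hmem := h.sub_matrixSection_mem hp hq hs0 hs hΦ hΦp hΦq hcl hx
      (1 - matrixSection p q x s (Φ b)⁻¹ * b)
    rw [map_sub, map_mul, map_one, map_matrixSection hs0 hΦp hΦq,
      Matrix.nonsing_inv_mul _ ((Matrix.isUnit_iff_isUnit_det _).1 hu), sub_self, map_zero,
      sub_zero] at hmem
    refine hL.ne_top ((Ideal.eq_top_iff_one L).2 ?_)
    simpa using L.add_mem hmem (L.mul_mem_left (matrixSection p q x s (Φ b)⁻¹) hbL)

theorem TopGenerates.isUnit_of_forall_isUnit [CompleteSpace B] {p q : B} (h : TopGenerates p q)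
    (hp : p * p = p) (hq : q * q = q) (h0 : 0 ∈ spectrum ℂ (p * q * p))
    (h1 : 1 ∈ spectrum ℂ (p * q * p)) (h0' : (0 : ℂ) ∈ closure (spectrum ℂ (p * q * p) \ {0}))
    (h1' : (1 : ℂ) ∈ closure (spectrum ℂ (p * q * p) \ {1})) {b : B}
    (hb : ∀ x ∈ spectrum ℂ (p * q * p), ∀ Φ : B →ₐ[ℂ] Matrix (Fin 2) (Fin 2) ℂ, Continuous Φ →
      Φ p = !![1, 0; 0, 0] → (∃ s : ℂ, s * s = x * (1 - x) ∧ Φ q = !![x, s; s, 1 - x]) →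
      IsUnit (Φ b)) : IsUnit b := by
  obtain ⟨a, ha⟩ := h.exists_left_inverse hp hq h0 h1 h0' h1' hb
  obtain ⟨c, hc⟩ := h.exists_left_inverse hp hq h0 h1 h0' h1' (b := a) fun x hx Φ hΦ hΦp hΦq => by
    obtain ⟨u, hu⟩ := hb x hx Φ hΦ hΦp hΦq
    have : Φ a * u = 1 := by rw [hu, ← map_mul, ha, map_one]
    rw [← Units.inv_eq_of_mul_eq_one_left this]
    exact Units.isUnit _
  have : c = b := left_inv_eq_right_inv hc ha
  exact ⟨⟨b, a, this ▸ hc, ha⟩, rfl⟩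

theorem topGenerates_topologicalClosure_adjoin {p q : B} {S : Subalgebra ℂ B}
    (hS : S = (Algebra.adjoin ℂ {p, q}).topologicalClosure) (hp : p ∈ S) (hq : q ∈ S) :
    TopGenerates (⟨p, hp⟩ : S) ⟨q, hq⟩ := by
  intro T hT h1 hpT hqT b
  have hle : Algebra.adjoin ℂ {p, q} ≤ S := hS ▸ Subalgebra.le_topologicalClosure _
  have key : ∀ u (hu : u ∈ Algebra.adjoin ℂ {p, q}), ∀ t ∈ T, (⟨u, hle hu⟩ : S) * t ∈ T := by
    intro u hu
    induction hu using Algebra.adjoin_induction with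
    | mem u hu =>
      rcases hu with rfl | rfl
      · exact hpT
      · exact hqT
    | algebraMap r =>
      intro t ht
      have := T.smul_mem r ht
      rwa [Algebra.smul_def] at this
    | add u v hu hv ihu ihv =>
      intro t ht
      have := T.add_mem (ihu t ht) (ihv t ht)
      rwa [← add_mul] at this
    | mul u v hu hv ihu ihv =>
      intro t ht
      have := ihu _ (ihv t ht)
      rwa [← mul_assoc] at this
  have hb : (b : B) ∈ closure (Algebra.adjoin ℂ {p, q} : Set B) := by
    rw [← Subalgebra.topologicalClosure_coe, ← hS]
    exact b.2
  have hb' : b ∈ closure ((↑) ⁻¹' (Algebra.adjoin ℂ {p, q} : Set B) : Set S) := by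
    rw [Topology.IsInducing.subtypeVal.closure_eq_preimage_closure_image,
      Set.mem_preimage]
    refine closure_mono ?_ hb
    exact fun u hu => ⟨⟨u, hle hu⟩, hu, rfl⟩
  refine closure_minimal (fun u hu => ?_) hT hb'
  simpa using key u hu 1 h1

end TwoIdempotents

/-- **The two idempotents theorem.** -/
theorem two_idempotents_theorem
    {𝒜 : Type*} [NormedRing 𝒜] [NormedAlgebra ℂ 𝒜] [CompleteSpace 𝒜]
    (p q : 𝒜) (hp : p * p = p) (hq : q * q = q)
    (ℬ : Subalgebra ℂ 𝒜) (hℬ : ℬ = (Algebra.adjoin ℂ {p, q}).topologicalClosure)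
    (hpB : p ∈ ℬ) (hqB : q ∈ ℬ)
    -- `0` and `1` belong to the spectrum of `pqp` in `ℬ` and are cluster points of it
    (h0 : (0 : ℂ) ∈ spectrum ℂ (⟨p * q * p, mul_mem (mul_mem hpB hqB) hpB⟩ : ℬ))
    (h1 : (1 : ℂ) ∈ spectrum ℂ (⟨p * q * p, mul_mem (mul_mem hpB hqB) hpB⟩ : ℬ))
    (h0' : (0 : ℂ) ∈ closure
      ((spectrum ℂ (⟨p * q * p, mul_mem (mul_mem hpB hqB) hpB⟩ : ℬ)) \ {0}))
    (h1' : (1 : ℂ) ∈ closure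
      ((spectrum ℂ (⟨p * q * p, mul_mem (mul_mem hpB hqB) hpB⟩ : ℬ)) \ {1})) :
    -- (a) existence of the local matrix homomorphisms
    (∀ x ∈ spectrum ℂ (⟨p * q * p, mul_mem (mul_mem hpB hqB) hpB⟩ : ℬ),
      ∀ s : ℂ, s * s = x * (1 - x) →
        ∃ Φ : ℬ →ₐ[ℂ] Matrix (Fin 2) (Fin 2) ℂ, Continuous Φ ∧
          Φ ⟨p, hpB⟩ = !![1, 0; 0, 0] ∧ Φ ⟨q, hqB⟩ = !![x, s; s, 1 - x]) ∧
    -- (b) invertibility criterion in `ℬ`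
    (∀ b : ℬ, IsUnit b ↔
      ∀ x ∈ spectrum ℂ (⟨p * q * p, mul_mem (mul_mem hpB hqB) hpB⟩ : ℬ),
        ∀ Φ : ℬ →ₐ[ℂ] Matrix (Fin 2) (Fin 2) ℂ, Continuous Φ →
          Φ ⟨p, hpB⟩ = !![1, 0; 0, 0] →
          (∃ s : ℂ, s * s = x * (1 - x) ∧ Φ ⟨q, hqB⟩ = !![x, s; s, 1 - x]) →
          IsUnit (Φ b)) := by
  have hp' : (⟨p, hpB⟩ : ℬ) * ⟨p, hpB⟩ = ⟨p, hpB⟩ := Subtype.ext hp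
  have hq' : (⟨q, hqB⟩ : ℬ) * ⟨q, hqB⟩ = ⟨q, hqB⟩ := Subtype.ext hq
  have hcl : IsClosed (ℬ : Set 𝒜) := hℬ ▸ Subalgebra.isClosed_topologicalClosure _
  have : CompleteSpace ℬ := hcl.completeSpace_coe
  have h := TwoIdempotents.topGenerates_topologicalClosure_adjoin hℬ hpB hqB
  exact ⟨fun x hx s hs => h.exists_algHom hp' hq' h0' h1' hx hs, fun b =>
    ⟨fun hb x hx Φ _ _ _ => hb.map Φ, h.isUnit_of_forall_isUnit hp' hq' h0 h1 h0' h1'⟩⟩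
end
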